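/- Let W be a finite-dimensional real vector space and let V = W × W* carry the nondegenerate symmetric bilinear form B((x,ξ),(y,η)) = ξ(y) + η(x). Let ρ : V → W be the projection onto the first factor. If K ⊆ V is an isotropic subspace, then K ∩ ({0} × W*) = {0} × Ann(ρ(K⊥)), where Ann(U) = {ξ ∈ W* : ξ(u) = 0 for all u ∈ U} and K⊥ is the B-orthogonal of K. -/

import Mathlib

/-- The `B`-orthogonal of a subspace `S`:
`orthB B S = {v | ∀ s ∈ S, B v s = 0}`. -/
def orthB {V : Type*} [AddCommGroup V] [Module ℝ V]
    (B : V →ₗ[ℝ] V →ₗ[ℝ] ℝ) (S : Submodule ℝ V) : Submodule ℝ V :=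
  ⨅ s ∈ S, LinearMap.ker (B.flip s)

/-- The canonical pairing `B((x,ξ),(y,η)) = ξ(y) + η(x)` on `W × W*`. -/
noncomputable def pairB (W : Type*) [AddCommGroup W] [Module ℝ W] :
    (W × Module.Dual ℝ W) →ₗ[ℝ] (W × Module.Dual ℝ W) →ₗ[ℝ] ℝ :=
  LinearMap.mk₂ ℝ (fun p q => p.2 q.1 + q.2 p.1)
    (by intro m₁ m₂ n; simp [map_add]; ring)
    (by intro c m n; simp [map_smul, smul_eq_mul]; ring)
    (by intro m n₁ n₂; simp [map_add]; ring)
    (by intro c m n; simp [map_smul, smul_eq_mul]; ring)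

theorem mem_orthB {V : Type*} [AddCommGroup V] [Module ℝ V]
    {B : V →ₗ[ℝ] V →ₗ[ℝ] ℝ} {S : Submodule ℝ V} {v : V} :
    v ∈ orthB B S ↔ ∀ s ∈ S, B v s = 0 := by
  simp [orthB, Submodule.mem_iInf]

@[simp]
theorem pairB_apply {W : Type*} [AddCommGroup W] [Module ℝ W] (p q : W × Module.Dual ℝ W) :
    pairB W p q = p.2 q.1 + q.2 p.1 := rfl

/-- Every linear form on `W × W*` is represented by the canonical pairing. -/
theorem pairB_surjective (W : Type*) [AddCommGroup W] [Module ℝ W] [FiniteDimensional ℝ W] :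
    Function.Surjective (pairB W) := by
  intro f
  refine ⟨((Module.evalEquiv ℝ W).symm (f ∘ₗ LinearMap.inr ℝ W (Module.Dual ℝ W)),
    f ∘ₗ LinearMap.inl ℝ W (Module.Dual ℝ W)), LinearMap.ext fun q => ?_⟩
  simp [← map_add]

/-- A vector orthogonal to `K⊥` lies in `K`. -/
theorem mem_of_forall_orthB_pairB {W : Type*} [AddCommGroup W] [Module ℝ W]
    [FiniteDimensional ℝ W] {K : Submodule ℝ (W × Module.Dual ℝ W)} {v : W × Module.Dual ℝ W}
    (h : ∀ u ∈ orthB (pairB W) K, pairB W u v = 0) : v ∈ K := by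
  rw [← Subspace.forall_mem_dualAnnihilator_apply_eq_zero_iff]
  intro f hf
  obtain ⟨u, rfl⟩ := pairB_surjective W f
  exact h u (mem_orthB.2 ((Submodule.mem_dualAnnihilator _).1 hf))

theorem stmt12
    {W : Type*} [AddCommGroup W] [Module ℝ W] [FiniteDimensional ℝ W]
    (K : Submodule ℝ (W × Module.Dual ℝ W))
    -- K is isotropic
    (hK : K ≤ orthB (pairB W) K) :
    K ⊓ (Submodule.prod (⊥ : Submodule ℝ W) (⊤ : Submodule ℝ (Module.Dual ℝ W)))
      = Submodule.prod (⊥ : Submodule ℝ W)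
          (Submodule.dualAnnihilator
            ((orthB (pairB W) K).map (LinearMap.fst ℝ W (Module.Dual ℝ W)))) := by
  ext ⟨x, ξ⟩
  simp only [Submodule.mem_inf, Submodule.mem_prod, Submodule.mem_bot, Submodule.mem_top,
    and_true, Submodule.mem_dualAnnihilator]
  constructor
  · rintro ⟨hv, rfl⟩
    refine ⟨rfl, ?_⟩
    rintro _ ⟨u, hu, rfl⟩
    simpa using mem_orthB.1 hu _ hv
  · rintro ⟨rfl, hξ⟩
    refine ⟨mem_of_forall_orthB_pairB fun u hu => ?_, rfl⟩
    simpa using hξ u.1 (Submodule.mem_map_of_mem hu)
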